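/- Let G=(V,E) be a finite connected graph with m edges, let t_unif be the uniform mixing time of the lazy random walk, and let 𝓙_t be the weighted number of intersections of two independent lazy random walks started at x counted over the time window [t_unif, t_unif+t−1]. Then for every vertex x and integer t ≥ 1, (3/4)²·t²/(2m) ≤ E_x[𝓙_t] ≤ (5/4)²·t²/(2m). -/

import Mathlib

open Finset
open scoped Classical BigOperators

/-- The transition matrix of the lazy random walk on a finite graph `G`. -/
noncomputable def lazyP {V : Type} [Fintype V] (G : SimpleGraph V) : Matrix V V ℝ :=
  fun u v =>
    if u = v then 1 / 2
    else if G.Adj u v then 1 / (2 * (G.degree u : ℝ)) else 0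

/-- The number of edges of `G`. -/
noncomputable def numEdges {V : Type} [Fintype V] (G : SimpleGraph V) : ℕ :=
  G.edgeFinset.card

/-- The stationary distribution `π(u) = deg(u) / (2m)` of the lazy random walk. -/
noncomputable def statDist {V : Type} [Fintype V] (G : SimpleGraph V) (u : V) : ℝ :=
  (G.degree u : ℝ) / (2 * (numEdges G : ℝ))

/-- The second-largest eigenvalue `λ₂` of a reversible transition matrix: the supremum of
the (real) eigenvalues different from `1`. -/
noncomputable def secondEig {V : Type} [Fintype V] (P : Matrix V V ℝ) : ℝ :=
  sSup {r : ℝ | r ≠ 1 ∧ ∃ f : V → ℝ, f ≠ 0 ∧ P.mulVec f = r • f}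

/-- The relaxation time `t_rel = ⌈1 / (1 - λ₂)⌉`. -/
noncomputable def relTime {V : Type} [Fintype V] (P : Matrix V V ℝ) : ℕ :=
  ⌈1 / (1 - secondEig P)⌉₊

/-- The uniform mixing time of the lazy random walk on `G`. -/
noncomputable def unifTime {V : Type} [Fintype V] (G : SimpleGraph V) : ℕ :=
  sInf {t : ℕ | ∀ x y : V, |(lazyP G ^ t) x y / statDist G y - 1| ≤ 1 / 4}

/-- The Green's function `g_t(x, u) = ∑_{i<t} P^i(x, u)`. -/
noncomputable def green {V : Type} [Fintype V] (P : Matrix V V ℝ) (t : ℕ) (x u : V) : ℝ :=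
  ∑ i ∈ Finset.range t, (P ^ i) x u

/-- The value of a finite trajectory at a natural number index (junk beyond the horizon). -/
noncomputable def traj {V : Type} [Nonempty V] {t : ℕ} (p : Fin t → V) (i : ℕ) : V :=
  if h : i < t then p ⟨i, h⟩ else Classical.arbitrary V

/-- The probability that the chain `P` started at `x` follows the length-`t` trajectory `p`. -/
noncomputable def pathWeight {V : Type} [Fintype V] [Nonempty V] (P : Matrix V V ℝ)
    (x : V) (t : ℕ) (p : Fin t → V) : ℝ :=
  (if traj p 0 = x then 1 else 0) *
    ∏ i ∈ Finset.range (t - 1), P (traj p i) (traj p (i + 1))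

/-- Expectation of a functional of two independent length-`t` walks started at `x` and `y`. -/
noncomputable def E2 {V : Type} [Fintype V] [Nonempty V] (P : Matrix V V ℝ) (x y : V)
    (t : ℕ) (F : (Fin t → V) → (Fin t → V) → ℝ) : ℝ :=
  ∑ p : Fin t → V, ∑ q : Fin t → V, pathWeight P x t p * pathWeight P y t q * F p q

/-- Expectation of a functional of three independent length-`t` walks started at `x`. -/
noncomputable def E3 {V : Type} [Fintype V] [Nonempty V] (P : Matrix V V ℝ) (x : V)
    (t : ℕ) (F : (Fin t → V) → (Fin t → V) → (Fin t → V) → ℝ) : ℝ :=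
  ∑ p : Fin t → V, ∑ q : Fin t → V, ∑ r : Fin t → V,
    pathWeight P x t p * pathWeight P x t q * pathWeight P x t r * F p q r

/-- Expectation of a functional of `2K` independent length-`t` walks
(`K` pairs) started at `x`. -/
noncomputable def EK {V : Type} [Fintype V] [Nonempty V] (P : Matrix V V ℝ) (x : V)
    (t K : ℕ) (F : (Fin K → Fin t → V) → (Fin K → Fin t → V) → ℝ) : ℝ :=
  ∑ X : Fin K → Fin t → V, ∑ Y : Fin K → Fin t → V,
    (∏ k, pathWeight P x t (X k)) * (∏ k, pathWeight P x t (Y k)) * F X Y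

/-- Expectation of a functional of `K` independent length-`t` walks started at `x`. -/
noncomputable def EKone {V : Type} [Fintype V] [Nonempty V] (P : Matrix V V ℝ) (x : V)
    (t K : ℕ) (F : (Fin K → Fin t → V) → ℝ) : ℝ :=
  ∑ X : Fin K → Fin t → V, (∏ k, pathWeight P x t (X k)) * F X

/-- The weighted number of intersections of two trajectories over the time window `[a, b)`:
`∑_{i,j=a}^{b-1} (1 / deg(p_i)) 1{p_i = q_j}`. -/
noncomputable def wInterIco {V : Type} [Fintype V] [Nonempty V] (G : SimpleGraph V)
    (a b : ℕ) {t : ℕ} (p q : Fin t → V) : ℝ :=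
  ∑ i ∈ Finset.Ico a b, ∑ j ∈ Finset.Ico a b,
    if traj p i = traj q j then 1 / (G.degree (traj p i) : ℝ) else 0

/-- The weighted number of intersections `𝓘_t` of two trajectories, up to time `t - 1`. -/
noncomputable def wInter {V : Type} [Fintype V] [Nonempty V] (G : SimpleGraph V)
    {t : ℕ} (p q : Fin t → V) : ℝ :=
  wInterIco G 0 t p q

/-- The (unweighted) number of intersections `I_t` of two trajectories, up to time `t - 1`. -/
noncomputable def nInter {V : Type} [Nonempty V] {t : ℕ} (p q : Fin t → V) : ℝ :=
  ∑ i ∈ Finset.range t, ∑ j ∈ Finset.range t,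
    if traj p i = traj q j then (1 : ℝ) else 0

/-- `E_{x,y}[𝓘_t]`: expected weighted number of intersections of two independent lazy random
walks started at `x` and `y`. -/
noncomputable def EIxy {V : Type} [Fintype V] [Nonempty V] (G : SimpleGraph V)
    (x y : V) (t : ℕ) : ℝ :=
  E2 (lazyP G) x y t fun p q => wInter G p q

/-- `E_x[𝓘_t]`. -/
noncomputable def EI {V : Type} [Fintype V] [Nonempty V] (G : SimpleGraph V)
    (x : V) (t : ℕ) : ℝ :=
  EIxy G x x t

/-- `E_x[𝓘_t²]`. -/
noncomputable def EIsq {V : Type} [Fintype V] [Nonempty V] (G : SimpleGraph V)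
    (x : V) (t : ℕ) : ℝ :=
  E2 (lazyP G) x x t fun p q => (wInter G p q) ^ 2

/-- `E_x[𝓙_t]`: expected weighted number of intersections over the window
`[t_unif, t_unif + t - 1]`. -/
noncomputable def EJ {V : Type} [Fintype V] [Nonempty V] (G : SimpleGraph V)
    (x : V) (t : ℕ) : ℝ :=
  E2 (lazyP G) x x (unifTime G + t) fun p q =>
    wInterIco G (unifTime G) (unifTime G + t) p q

/-- `E_x[𝓙_t²]`. -/
noncomputable def EJsq {V : Type} [Fintype V] [Nonempty V] (G : SimpleGraph V)
    (x : V) (t : ℕ) : ℝ :=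
  E2 (lazyP G) x x (unifTime G + t) fun p q =>
    (wInterIco G (unifTime G) (unifTime G + t) p q) ^ 2

/-- `E_x[ℒ_t]`: expected weighted number of intersections between times `t` and `2t - 1`. -/
noncomputable def EL {V : Type} [Fintype V] [Nonempty V] (G : SimpleGraph V)
    (x : V) (t : ℕ) : ℝ :=
  E2 (lazyP G) x x (2 * t) fun p q => wInterIco G t (2 * t) p q

/-- `E_x[ℒ_t²]`. -/
noncomputable def ELsq {V : Type} [Fintype V] [Nonempty V] (G : SimpleGraph V)
    (x : V) (t : ℕ) : ℝ :=
  E2 (lazyP G) x x (2 * t) fun p q => (wInterIco G t (2 * t) p q) ^ 2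

/-- `E_x[ℒ_t^{(X,Y)} · ℒ_t^{(X,Z)}]` for three independent walks `X, Y, Z` started at `x`. -/
noncomputable def ELprod {V : Type} [Fintype V] [Nonempty V] (G : SimpleGraph V)
    (x : V) (t : ℕ) : ℝ :=
  E3 (lazyP G) x (2 * t) fun p q r =>
    wInterIco G t (2 * t) p q * wInterIco G t (2 * t) p r

/-- The inner product `⟨f, g⟩_π = ∑_x π(x) f(x) g(x)`. -/
noncomputable def ipi {X : Type} [Fintype X] (π : X → ℝ) (f g : X → ℝ) : ℝ :=
  ∑ x, π x * f x * g x

/-- The position of the first occurrence of `s i` in the finite sequence `s`. -/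
noncomputable def firstOcc {V : Type} {N : ℕ} (s : Fin N → V) (i : Fin N) : ℕ :=
  sInf {j : ℕ | ∃ h : j < N, s ⟨j, h⟩ = s i}

/-- The index (rank) of first occurrence of `s i` among the distinct values of `s`,
in order of first appearance. -/
noncomputable def rankSeq {V : Type} {N : ℕ} (s : Fin N → V) (i : Fin N) : ℕ :=
  ((Finset.univ.image fun j : Fin N => firstOcc s j).filter
    fun a => a ≤ firstOcc s i).card

/-- The profile `Φ` of a finite sequence of vertices: the sequence of ranks of first
occurrence together with the sequence of degrees. -/
noncomputable def profileOf {V : Type} [Fintype V] (G : SimpleGraph V) {N : ℕ}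
    (s : Fin N → V) : Fin N → ℕ × ℕ :=
  fun i => (rankSeq s i, G.degree (s i))

/-- Concatenation of `K` trajectories of length `t` into one sequence of length `K * t`. -/
noncomputable def concatW {V : Type} [Nonempty V] {K t : ℕ} (X : Fin K → Fin t → V)
    (i : Fin (K * t)) : V :=
  if h : 0 < t then
    X ⟨i.1 / t, (Nat.div_lt_iff_lt_mul h).2 i.2⟩ ⟨i.1 % t, Nat.mod_lt _ h⟩
  else Classical.arbitrary V

lemma traj_cons_zero {V : Type} [Nonempty V] {n : ℕ} (v : V) (p : Fin n → V) :
    traj (Fin.cons v p : Fin (n+1) → V) 0 = v := by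
  simp [traj]

lemma traj_cons_succ {V : Type} [Nonempty V] {n : ℕ} (v : V) (p : Fin n → V) (i : ℕ) :
    traj (Fin.cons v p : Fin (n+1) → V) (i+1) = traj p i := by
  unfold traj
  by_cases h : i < n
  · have h' : i + 1 < n + 1 := by omega
    rw [dif_pos h, dif_pos h']
    exact Fin.cons_succ (α := fun _ => V) v p ⟨i, h⟩
  · rw [dif_neg h, dif_neg (by omega)]

lemma pathWeight_cons {V : Type} [Fintype V] [Nonempty V] (P : Matrix V V ℝ)
    (x v : V) (n : ℕ) (p : Fin (n+1) → V) :
    pathWeight P x (n+2) (Fin.cons v p) =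
      if v = x then ∑ y, P x y * pathWeight P y (n+1) p else 0 := by
  unfold pathWeight
  have h1 : n + 2 - 1 = n + 1 := rfl
  have h2 : n + 1 - 1 = n := rfl
  rw [h1, h2, Finset.prod_range_succ']
  simp only [traj_cons_zero, traj_cons_succ]
  by_cases h : v = x
  · subst h
    simp [mul_comm]
  · simp [h]

lemma marginal {V : Type} [Fintype V] [Nonempty V] (P : Matrix V V ℝ)
    (hP : ∀ x, ∑ y, P x y = 1) (n : ℕ) : ∀ (x : V) (i : ℕ) (_ : i ≤ n) (f : V → ℝ),
    ∑ p : Fin (n+1) → V, pathWeight P x (n+1) p * f (traj p i) = ∑ u, (P ^ i) x u * f u := by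
  induction n with
  | zero =>
    intro x i hi f
    obtain rfl : i = 0 := by omega
    rw [← (Equiv.funUnique (Fin 1) V).symm.sum_comp]
    simp [pathWeight, traj, Matrix.one_apply, eq_comm]
  | succ n ih =>
    intro x i hi f
    rw [← (Fin.consEquiv (fun _ : Fin (n+2) => V)).sum_comp, Fintype.sum_prod_type]
    have key : ∀ g : (Fin (n+2) → V) → ℝ,
        ∑ v : V, ∑ p : Fin (n+1) → V,
          pathWeight P x (n+2) (Fin.cons v p : Fin (n+2) → V) * g (Fin.cons v p : Fin (n+2) → V) =
        ∑ y, P x y * ∑ p : Fin (n+1) → V, pathWeight P y (n+1) p *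
          g (Fin.cons x p : Fin (n+2) → V) := by
      intro g
      rw [Finset.sum_eq_single x]
      · simp only [pathWeight_cons, if_true, Finset.sum_mul, Finset.mul_sum]
        rw [Finset.sum_comm]
        simp only [mul_assoc]
      · intro b _ hb
        simp [pathWeight_cons, hb]
      · simp
    have key2 := key (fun p => f (traj p i))
    simp only [Fin.consEquiv, Equiv.coe_fn_mk]
    rw [key2]
    cases i with
    | zero =>
      simp only [traj_cons_zero]
      have : ∀ y, ∑ p : Fin (n+1) → V, pathWeight P y (n+1) p * f x = f x := by
        intro y
        have := ih y 0 (by omega) (fun _ => f x)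
        rw [this]
        simp [Matrix.one_apply]
      simp only [this, ← Finset.sum_mul, hP]
      simp [Matrix.one_apply]
    | succ i =>
      simp only [traj_cons_succ]
      simp only [ih _ i (by omega) f, pow_succ', Matrix.mul_apply, Finset.sum_mul, Finset.mul_sum]
      rw [Finset.sum_comm]
      simp only [mul_assoc]

section chain
variable {V : Type} [Fintype V] [Nontrivial V] (G : SimpleGraph V)

lemma deg_pos' (hG : G.Connected) (u : V) : (0:ℝ) < G.degree u := by
  exact_mod_cast hG.preconnected.degree_pos_of_nontrivial u

lemma sum_deg' : ∑ u, (G.degree u : ℝ) = 2 * (numEdges G : ℝ) := by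
  unfold numEdges
  exact_mod_cast G.sum_degrees_eq_twice_card_edges

lemma m_pos' (hG : G.Connected) : (0:ℝ) < 2 * (numEdges G : ℝ) := by
  rw [← sum_deg']
  exact Finset.sum_pos (fun u _ => deg_pos' G hG u) Finset.univ_nonempty

lemma pi_pos (hG : G.Connected) (u : V) : 0 < statDist G u :=
  div_pos (deg_pos' G hG u) (m_pos' G hG)

lemma pi_sum (hG : G.Connected) : ∑ u, statDist G u = 1 := by
  unfold statDist
  rw [← Finset.sum_div, sum_deg', div_self (m_pos' G hG).ne']

lemma P_nonneg (u v : V) : 0 ≤ lazyP G u v := by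
  unfold lazyP
  split_ifs <;> positivity

lemma P_eq (u v : V) : lazyP G u v = (if u = v then 1/2 else 0) +
    (if G.Adj u v then 1 / (2 * (G.degree u : ℝ)) else 0) := by
  unfold lazyP
  by_cases h : u = v
  · subst h; simp
  · simp [h]

lemma P_row (hG : G.Connected) (u : V) : ∑ v, lazyP G u v = 1 := by
  simp only [P_eq, Finset.sum_add_distrib]
  have := deg_pos' G hG u
  rw [← Finset.sum_filter (fun v => G.Adj u v)]
  have h2 : (Finset.univ.filter fun v => G.Adj u v).card = G.degree u := by
    rw [← SimpleGraph.card_neighborFinset_eq_degree, SimpleGraph.neighborFinset_eq_filter]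
  rw [Finset.sum_const, h2]
  simp
  field_simp
  norm_num

lemma P_stat (hG : G.Connected) (v : V) :
    ∑ u, statDist G u * lazyP G u v = statDist G v := by
  have h : ∀ u, statDist G u * lazyP G u v = statDist G v * lazyP G v u := by
    intro u
    have h1 := deg_pos' G hG u
    have h2 := deg_pos' G hG v
    have h3 := m_pos' G hG
    have h4 : (0:ℝ) < numEdges G := by linarith
    by_cases h : u = v
    · subst h; rfl
    · by_cases ha : G.Adj u v
      · have ha' := ha.symm
        simp only [lazyP, statDist, h, Ne.symm h, ha, ha', if_true, if_false]
        field_simp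
      · have ha' : ¬ G.Adj v u := fun h => ha h.symm
        simp [lazyP, h, Ne.symm h, ha, ha']
  simp only [h, ← Finset.mul_sum, P_row G hG, mul_one]

lemma Pn_nonneg (n : ℕ) (u v : V) : 0 ≤ (lazyP G ^ n) u v := by
  induction n generalizing u with
  | zero => simp only [pow_zero, Matrix.one_apply]; split_ifs <;> norm_num
  | succ n ih =>
    rw [pow_succ', Matrix.mul_apply]
    exact Finset.sum_nonneg fun w _ => mul_nonneg (P_nonneg G u w) (ih w)

lemma Pn_row (hG : G.Connected) (n : ℕ) (u : V) : ∑ v, (lazyP G ^ n) u v = 1 := by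
  induction n generalizing u with
  | zero => simp [Matrix.one_apply]
  | succ n ih =>
    simp only [pow_succ', Matrix.mul_apply]
    rw [Finset.sum_comm]
    simp only [← Finset.mul_sum, ih, mul_one, P_row G hG]

lemma Pn_stat (hG : G.Connected) (n : ℕ) (v : V) :
    ∑ u, statDist G u * (lazyP G ^ n) u v = statDist G v := by
  induction n generalizing v with
  | zero => simp [Matrix.one_apply]
  | succ n ih =>
    simp only [pow_succ, Matrix.mul_apply, Finset.mul_sum]
    rw [Finset.sum_comm]
    simp only [← mul_assoc, ← Finset.sum_mul, ih, P_stat G hG]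

lemma Pn_pos_step (n : ℕ) (u w v : V) (h : 0 < lazyP G u w) (h' : 0 < (lazyP G ^ n) w v) :
    0 < (lazyP G ^ (n+1)) u v := by
  rw [pow_succ', Matrix.mul_apply]
  exact Finset.sum_pos' (fun z _ => mul_nonneg (P_nonneg G u z) (Pn_nonneg G n z v))
    ⟨w, Finset.mem_univ _, mul_pos h h'⟩

lemma Pn_pos_mono {n k : ℕ} (h : n ≤ k) (u v : V) (h' : 0 < (lazyP G ^ n) u v) :
    0 < (lazyP G ^ k) u v := by
  induction k, h using Nat.le_induction with
  | base => exact h'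
  | succ k _ ih => exact Pn_pos_step G k u u v (by simp [lazyP]) ih

lemma exists_pos (hG : G.Connected) (u v : V) : ∃ n, 0 < (lazyP G ^ n) u v := by
  obtain ⟨w⟩ := hG.preconnected u v
  induction w with
  | nil => exact ⟨0, by simp⟩
  | @cons a b c hab _ ih =>
    obtain ⟨n, hn⟩ := ih
    refine ⟨n+1, Pn_pos_step G n a b c ?_ hn⟩
    have := deg_pos' G hG a
    simp only [lazyP, hab.ne, hab, if_true, if_false]
    positivity

lemma exists_unif_pos (hG : G.Connected) : ∃ N, ∀ u v, 0 < (lazyP G ^ N) u v := by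
  choose f hf using exists_pos G hG
  refine ⟨∑ u, ∑ v, f u v, fun u v => Pn_pos_mono G ?_ u v (hf u v)⟩
  exact (Finset.single_le_sum (f := fun v => f u v) (fun _ _ => Nat.zero_le _)
    (Finset.mem_univ v)).trans (Finset.single_le_sum (f := fun u => ∑ v, f u v)
      (fun _ _ => Nat.zero_le _) (Finset.mem_univ u))

lemma pi_le_one (hG : G.Connected) (v : V) : statDist G v ≤ 1 := by
  rw [← pi_sum G hG]
  exact Finset.single_le_sum (fun u _ => (pi_pos G hG u).le) (Finset.mem_univ v)

lemma unif_nonempty (hG : G.Connected) :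
    {t : ℕ | ∀ x y : V, |(lazyP G ^ t) x y / statDist G y - 1| ≤ 1 / 4}.Nonempty := by
  obtain ⟨N, hN⟩ := exists_unif_pos G hG
  obtain ⟨⟨a, b⟩, hab⟩ := Finite.exists_min (fun z : V × V => (lazyP G ^ N) z.1 z.2)
  obtain ⟨c, hc⟩ := Finite.exists_min (fun z : V => statDist G z)
  set ε := (lazyP G ^ N) a b with hε
  have ε0 : 0 < ε := hN a b
  have hge : ∀ x y, ε * statDist G y ≤ (lazyP G ^ N) x y := fun x y => by
    have := hab (x, y)
    simp only at this
    nlinarith [pi_le_one G hG y]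
  have ε1 : ε ≤ 1 := by
    have := Finset.sum_le_sum (fun y (_ : y ∈ (Finset.univ : Finset V)) => hge a y)
    rwa [← Finset.mul_sum, pi_sum G hG, Pn_row G hG, mul_one] at this
  have hk : ∀ k x y, |(lazyP G ^ (N * k)) x y - statDist G y| ≤ (1 - ε) ^ k := by
    intro k
    induction k with
    | zero =>
      intro x y
      have h1 := pi_pos G hG y
      have h2 := pi_le_one G hG y
      simp only [mul_zero, pow_zero, Matrix.one_apply]
      split_ifs <;> rw [abs_le] <;> constructor <;> linarith
    | succ k ih =>
      intro x y
      have e : (lazyP G ^ (N * (k+1))) x y - statDist G y =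
          ∑ z, ((lazyP G ^ N) x z - ε * statDist G z) *
            ((lazyP G ^ (N*k)) z y - statDist G y) := by
        have : N * (k+1) = N + N * k := by ring
        rw [this, pow_add, Matrix.mul_apply]
        simp only [sub_mul, mul_sub, Finset.sum_sub_distrib, ← Finset.sum_mul, mul_assoc,
          ← Finset.mul_sum, Pn_row G hG, Pn_stat G hG, pi_sum G hG]
        ring
      rw [e]
      calc _ ≤ ∑ z, |((lazyP G ^ N) x z - ε * statDist G z) *
            ((lazyP G ^ (N*k)) z y - statDist G y)| := Finset.abs_sum_le_sum_abs _ _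
        _ ≤ ∑ z, ((lazyP G ^ N) x z - ε * statDist G z) * (1 - ε) ^ k := by
          refine Finset.sum_le_sum fun z _ => ?_
          have h0 := sub_nonneg.2 (hge x z)
          rw [abs_mul, abs_of_nonneg h0]
          exact mul_le_mul_of_nonneg_left (ih z y) h0
        _ = _ := by
          rw [← Finset.sum_mul, Finset.sum_sub_distrib, ← Finset.mul_sum, Pn_row G hG,
            pi_sum G hG, pow_succ]
          ring
  have c0 := pi_pos G hG c
  obtain ⟨k, hk'⟩ := exists_pow_lt_of_lt_one (show 0 < statDist G c / 4 by positivity)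
    (show 1 - ε < 1 by linarith)
  refine ⟨N * k, fun x y => ?_⟩
  have hy := pi_pos G hG y
  have e : (lazyP G ^ (N * k)) x y / statDist G y - 1 =
      ((lazyP G ^ (N * k)) x y - statDist G y) / statDist G y := by
    field_simp
  rw [e, abs_div, abs_of_pos hy, div_le_iff₀ hy]
  have := hk k x y
  have := hc y
  linarith

lemma mixed (hG : G.Connected) (n : ℕ) (hn : unifTime G ≤ n) : ∀ (x y : V),
    3/4 * statDist G y ≤ (lazyP G ^ n) x y ∧ (lazyP G ^ n) x y ≤ 5/4 * statDist G y := by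
  induction n, hn using Nat.le_induction with
  | base =>
    intro x y
    have h := Nat.sInf_mem (unif_nonempty G hG) x y
    have hy := pi_pos G hG y
    change |(lazyP G ^ (unifTime G)) x y / statDist G y - 1| ≤ 1/4 at h
    rw [abs_le] at h
    rw [← le_div_iff₀ hy, ← div_le_iff₀ hy]
    constructor <;> linarith
  | succ n _ ih =>
    intro x y
    rw [pow_succ', Matrix.mul_apply]
    have h : ∀ a : ℝ, a = ∑ z, lazyP G x z * a := fun a => by
      rw [← Finset.sum_mul, P_row G hG, one_mul]
    constructor
    · rw [h (3/4 * statDist G y)]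
      exact Finset.sum_le_sum fun z _ => mul_le_mul_of_nonneg_left (ih z y).1 (P_nonneg G x z)
    · rw [h (5/4 * statDist G y)]
      exact Finset.sum_le_sum fun z _ => mul_le_mul_of_nonneg_left (ih z y).2 (P_nonneg G x z)

lemma E2_eq (hG : G.Connected) (x : V) (a n : ℕ) :
    E2 (lazyP G) x x (n+1) (fun p q => wInterIco G a (n+1) p q) =
    ∑ i ∈ Finset.Ico a (n+1), ∑ j ∈ Finset.Ico a (n+1),
      ∑ u, (lazyP G ^ i) x u * ((lazyP G ^ j) x u / (G.degree u : ℝ)) := by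
  unfold E2 wInterIco
  simp only [Finset.mul_sum]
  have step : ∀ p : Fin (n+1) → V, ∀ g : (Fin (n+1) → V) → ℕ → ℕ → ℝ,
      ∑ q : Fin (n+1) → V, ∑ i ∈ Finset.Ico a (n+1), ∑ j ∈ Finset.Ico a (n+1), g q i j =
      ∑ i ∈ Finset.Ico a (n+1), ∑ j ∈ Finset.Ico a (n+1), ∑ q : Fin (n+1) → V, g q i j := by
    intro p g
    rw [Finset.sum_comm]
    exact Finset.sum_congr rfl fun i _ => Finset.sum_comm
  have step1 := fun p => step p (fun q i j => pathWeight (lazyP G) x (n+1) p *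
    pathWeight (lazyP G) x (n+1) q *
      (if traj p i = traj q j then 1 / (G.degree (traj p i) : ℝ) else 0))
  simp only [step1]
  rw [Finset.sum_comm]
  refine Finset.sum_congr rfl fun i hi => ?_
  rw [Finset.sum_comm]
  refine Finset.sum_congr rfl fun j hj => ?_
  rw [Finset.mem_Ico] at hi hj
  rw [← marginal (lazyP G) (P_row G hG) n x i (by omega)
    (fun u => (lazyP G ^ j) x u / (G.degree u : ℝ))]
  refine Finset.sum_congr rfl fun p _ => ?_
  have := marginal (lazyP G) (P_row G hG) n x j (by omega)
    (fun u => if traj p i = u then 1 / (G.degree (traj p i) : ℝ) else 0)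
  simp only [mul_assoc, ← Finset.mul_sum]
  rw [this]
  simp [div_eq_mul_inv]

end chain

/-- For a finite connected graph `G` with `m` edges, every vertex `x` and
every `t ≥ 1`: `(3/4)² t²/(2m) ≤ E_x[𝓙_t] ≤ (5/4)² t²/(2m)`. -/
theorem expected_intersections_from_mixing_bounds
    {V : Type} [Fintype V] [Nontrivial V] (G : SimpleGraph V) (hG : G.Connected)
    (x : V) (t : ℕ) (ht : 1 ≤ t) :
    (3 / 4 : ℝ) ^ 2 * ((t : ℝ) ^ 2 / (2 * (numEdges G : ℝ))) ≤ EJ G x t ∧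
      EJ G x t ≤ (5 / 4 : ℝ) ^ 2 * ((t : ℝ) ^ 2 / (2 * (numEdges G : ℝ))) := by
  obtain ⟨s, rfl⟩ : ∃ s, t = s + 1 := ⟨t - 1, by omega⟩
  have hE : EJ G x (s+1) = _ := E2_eq G hG x (unifTime G) (unifTime G + s)
  rw [hE]
  have hm := m_pos' G hG
  have hs : ∀ c : ℝ, ∑ u, (c * statDist G u) * ((c * statDist G u) / (G.degree u : ℝ)) =
      c^2 * (1 / (2 * (numEdges G : ℝ))) := by
    intro c
    have : ∀ u, (c * statDist G u) * ((c * statDist G u) / (G.degree u : ℝ)) =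
        c^2 * (1 / (2 * (numEdges G : ℝ))) * statDist G u := by
      intro u
      have := deg_pos' G hG u
      have hm' : (0:ℝ) < numEdges G := by linarith
      simp only [statDist]
      field_simp
    simp only [this, ← Finset.mul_sum, pi_sum G hG, mul_one]
  have hc : ∀ c : ℝ, c ^ 2 * (((s+1 : ℕ) : ℝ) ^ 2 / (2 * (numEdges G : ℝ))) =
      ∑ i ∈ Finset.Ico (unifTime G) (unifTime G + s + 1),
      ∑ j ∈ Finset.Ico (unifTime G) (unifTime G + s + 1),
      ∑ u, (c * statDist G u) * ((c * statDist G u) / (G.degree u : ℝ)) := by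
    intro c
    have hcard : unifTime G + s + 1 - unifTime G = s + 1 := by omega
    rw [hs]
    simp only [Finset.sum_const, Nat.card_Ico, hcard, nsmul_eq_mul]
    ring
  rw [hc, hc]
  constructor <;>
  · refine Finset.sum_le_sum fun i hi => Finset.sum_le_sum fun j hj =>
      Finset.sum_le_sum fun u _ => ?_
    rw [Finset.mem_Ico] at hi hj
    have h1 := mixed G hG i hi.1 x u
    have h2 := mixed G hG j hj.1 x u
    have h3 := deg_pos' G hG u
    have h4 := pi_pos G hG u
    have h5 := Pn_nonneg G i x u
    have h6 := Pn_nonneg G j x u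
    first
    | exact mul_le_mul h1.1 (div_le_div_of_nonneg_right h2.1 h3.le) (by positivity) h5
    | exact mul_le_mul h1.2 (div_le_div_of_nonneg_right h2.2 h3.le) (by positivity) (by positivity)
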